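/- In the LIiP-style modal system, modal idempotency is derivable: ⊢ □□φ ↔ □φ. -/

import Mathlib

/-- Propositional modal formulas over atoms, with a unary modality `box`. -/
inductive Form : Type where
  | atom : Nat → Form
  | bot  : Form
  | and  : Form → Form → Form
  | or   : Form → Form → Form
  | imp  : Form → Form → Form
  | box  : Form → Form
deriving DecidableEq

/-- Intuitionistic negation. -/
def Form.neg (a : Form) : Form := a.imp .bot
/-- Biconditional. -/
def Form.iff (a b : Form) : Form := (a.imp b).and (b.imp a)

/-- A standard Hilbert system for intuitionistic propositional logic
(box-formulas are treated as opaque). -/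
inductive IPL : Form → Prop where
  | ax1 (a b : Form) : IPL (a.imp (b.imp a))
  | ax2 (a b c : Form) : IPL ((a.imp (b.imp c)).imp ((a.imp b).imp (a.imp c)))
  | andI (a b : Form) : IPL (a.imp (b.imp (a.and b)))
  | andE1 (a b : Form) : IPL ((a.and b).imp a)
  | andE2 (a b : Form) : IPL ((a.and b).imp b)
  | orI1 (a b : Form) : IPL (a.imp (a.or b))
  | orI2 (a b : Form) : IPL (b.imp (a.or b))
  | orE (a b c : Form) : IPL ((a.imp c).imp ((b.imp c).imp ((a.or b).imp c)))
  | exfalso (a : Form) : IPL (Form.bot.imp a)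
  | mp {a b : Form} : IPL (a.imp b) → IPL a → IPL b

/-- Modal idempotency: `⊢ □□φ ↔ □φ` in the LIiP-style modal system. -/
theorem modal_idempotency
    (Prv : Form → Prop) (k : Form)
    (hIPL : ∀ φ : Form, IPL φ → Prv φ)
    (hMP : ∀ φ ψ : Form, Prv (φ.imp ψ) → Prv φ → Prv ψ)
    (hK : ∀ φ ψ : Form, Prv (((φ.imp ψ).box).imp ((φ.box).imp ψ.box)))
    (hET : ∀ φ : Form, Prv ((φ.box).imp (k.imp φ)))
    (hSelf : Prv k.box)
    (hMM : ∀ φ : Form, Prv (φ.imp φ.box)) :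
    ∀ φ : Form, Prv (Form.iff φ.box.box φ.box) := by
  intro φ
  have nec : ∀ a : Form, Prv a → Prv a.box := fun a h => hMP _ _ (hMM a) h
  have weak : ∀ a b : Form, Prv b → Prv (a.imp b) := fun a b h => hMP _ _ (hIPL _ (IPL.ax1 b a)) h
  have dist : ∀ a b c : Form, Prv (a.imp (b.imp c)) → Prv (a.imp b) → Prv (a.imp c) :=
    fun a b c h1 h2 => hMP _ _ (hMP _ _ (hIPL _ (IPL.ax2 a b c)) h1) h2
  have trans : ∀ a b c : Form, Prv (a.imp b) → Prv (b.imp c) → Prv (a.imp c) :=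
    fun a b c h1 h2 => dist a b c (weak _ _ h2) h1
  have h1 : Prv (φ.box.box.imp (k.imp φ).box) := hMP _ _ (hK _ _) (nec _ (hET φ))
  have h2 : Prv (φ.box.box.imp (k.box.imp φ.box)) := trans _ _ _ h1 (hK k φ)
  have h3 : Prv (φ.box.box.imp φ.box) := dist _ _ _ h2 (weak _ _ hSelf)
  exact hMP _ _ (hMP _ _ (hIPL _ (IPL.andI _ _)) h3) (hMM φ.box)
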